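/- Let V : ℝ → ℝ be C^∞ with V(0)=0, V'(t)=0 if and only if t=0, V''(0)=2, and V(t) → ∞ as t → ±∞. Then J : (0,∞) → (0,∞), J(E) = (1/π) ∫_{t₋(E)}^{t₊(E)} √(E − V(t)) dt, extends to a C^∞-smooth function on [0,∞) with J(0)=0 and J'(0)=1/2. -/

import Mathlib

open Filter Set intervalIntegral

/-- Differentiation under the integral sign for a dilation parameter. -/
theorem hasDerivAt_integral_mul_comp_mul {w φ φ' : ℝ → ℝ} (hw : Continuous w)
    (hφ : ∀ x, HasDerivAt φ (φ' x) x) (hφ' : Continuous φ') (a b r : ℝ) :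
    HasDerivAt (fun r => ∫ s in a..b, w s * φ (r * s))
      (∫ s in a..b, w s * s * φ' (r * s)) r := by
  have hφc : Continuous φ := continuous_iff_continuousAt.2 fun x => (hφ x).continuousAt
  have hK : IsCompact (Metric.closedBall r 1 ×ˢ uIcc a b) :=
    (isCompact_closedBall r 1).prod isCompact_uIcc
  have hc : Continuous fun p : ℝ × ℝ => w p.2 * p.2 * φ' (p.1 * p.2) := by fun_prop
  obtain ⟨C, hC⟩ := hK.exists_bound_of_continuousOn hc.continuousOn
  refine (intervalIntegral.hasDerivAt_integral_of_dominated_loc_of_deriv_le (bound := fun _ => C)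
    (F := fun r s => w s * φ (r * s)) (F' := fun r s => w s * s * φ' (r * s))
    (Metric.closedBall_mem_nhds r one_pos) ?_ ?_ ?_ ?_ ?_ ?_).2
  · exact Eventually.of_forall fun x => Continuous.aestronglyMeasurable (by fun_prop)
  · exact Continuous.intervalIntegrable (by fun_prop) _ _
  · exact Continuous.aestronglyMeasurable (by fun_prop)
  · exact Eventually.of_forall fun t ht x hx => hC (x, t) ⟨hx, uIoc_subset_uIcc ht⟩
  · exact intervalIntegrable_const
  · refine Eventually.of_forall fun t _ x _ => ?_
    have h := ((hφ (x * t)).comp x ((hasDerivAt_id x).mul_const t)).const_mul (w t)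
    refine h.congr_deriv ?_
    simp only [one_mul]
    ring

theorem ContDiff.hasDerivAt_deriv_of_infty {φ : ℝ → ℝ} (hφ : ContDiff ℝ (⊤ : ℕ∞) φ) (x : ℝ) :
    HasDerivAt φ (deriv φ x) x :=
  ((hφ.differentiable (by simp)) x).hasDerivAt

theorem ContDiff.deriv_of_infty {φ : ℝ → ℝ} (hφ : ContDiff ℝ (⊤ : ℕ∞) φ) :
    ContDiff ℝ (⊤ : ℕ∞) (deriv φ) :=
  (contDiff_infty_iff_deriv.1 hφ).2

theorem contDiff_integral_mul_comp_mul {w φ : ℝ → ℝ} (hw : Continuous w)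
    (hφ : ContDiff ℝ (⊤ : ℕ∞) φ) (a b : ℝ) :
    ContDiff ℝ (⊤ : ℕ∞) (fun r => ∫ s in a..b, w s * φ (r * s)) := by
  refine contDiff_infty.2 fun n => ?_
  induction n generalizing w φ with
  | zero =>
    exact contDiff_zero.2 (continuous_iff_continuousAt.2 fun r =>
      (hasDerivAt_integral_mul_comp_mul hw hφ.hasDerivAt_deriv_of_infty
        hφ.deriv_of_infty.continuous a b r).continuousAt)
  | succ n ih =>
    have hd := hasDerivAt_integral_mul_comp_mul hw hφ.hasDerivAt_deriv_of_infty
        hφ.deriv_of_infty.continuous a b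
    push_cast
    refine contDiff_succ_iff_deriv.2 ⟨fun r => (hd r).differentiableAt, by simp, ?_⟩
    rw [funext fun r => (hd r).deriv]
    exact ih (by fun_prop) hφ.deriv_of_infty

/-- Hadamard's lemma in one variable. -/
theorem exists_contDiff_eq_mul {φ : ℝ → ℝ} (hφ : ContDiff ℝ (⊤ : ℕ∞) φ) (h0 : φ 0 = 0) :
    ∃ ψ : ℝ → ℝ, ContDiff ℝ (⊤ : ℕ∞) ψ ∧ (∀ x, φ x = x * ψ x) := by
  refine ⟨fun x => ∫ s in (0 : ℝ)..1, 1 * deriv φ (x * s),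
    contDiff_integral_mul_comp_mul continuous_const hφ.deriv_of_infty 0 1, fun x => ?_⟩
  simp only [one_mul]
  rw [mul_integral_comp_mul_left, integral_eq_sub_of_hasDerivAt
    (fun y _ => hφ.hasDerivAt_deriv_of_infty y)
    (hφ.deriv_of_infty.continuous.intervalIntegrable _ _)]
  simp [h0]

theorem exists_even_deriv_eq_mul {φ : ℝ → ℝ} (hφ : ContDiff ℝ (⊤ : ℕ∞) φ)
    (heven : ∀ x, φ (-x) = φ x) :
    ∃ ψ : ℝ → ℝ, ContDiff ℝ (⊤ : ℕ∞) ψ ∧ (∀ x, ψ (-x) = ψ x) ∧ ∀ x, deriv φ x = x * ψ x := by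
  have hodd : ∀ x, deriv φ (-x) = -deriv φ x := fun x => by
    have h := deriv_comp_neg φ x
    rw [funext heven] at h
    linarith
  obtain ⟨ψ, hψ, h⟩ := exists_contDiff_eq_mul hφ.deriv_of_infty (by
    have := hodd 0
    rw [neg_zero] at this
    linarith)
  refine ⟨ψ, hψ, fun x => ?_, h⟩
  rcases eq_or_ne x 0 with rfl | hx
  · simp
  · have := hodd x
    rw [h, h] at this
    exact mul_left_cancel₀ hx (by linarith)

/-- Integral averages of an even smooth function over dilations by `√E` are smooth in `E`,
up to the endpoint `E = 0`. -/
theorem contDiffOn_integral_mul_comp_sqrt_mul {w φ : ℝ → ℝ} (hw : Continuous w)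
    (hφ : ContDiff ℝ (⊤ : ℕ∞) φ) (heven : ∀ x, φ (-x) = φ x) (a b : ℝ) :
    ContDiffOn ℝ (⊤ : ℕ∞) (fun E => ∫ s in a..b, w s * φ (√E * s)) (Ici 0) := by
  refine contDiffOn_infty.2 fun n => ?_
  induction n generalizing w φ with
  | zero =>
    exact contDiffOn_zero.2 ((contDiff_integral_mul_comp_mul hw hφ a b).continuous.comp
      Real.continuous_sqrt).continuousOn
  | succ n ih =>
    obtain ⟨ψ, hψ, hψe, h⟩ := exists_even_deriv_eq_mul hφ heven
    set F : ℝ → ℝ := fun E => ∫ s in a..b, w s * φ (√E * s)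
    set G : ℝ → ℝ := fun E => ∫ s in a..b, w s * s ^ 2 / 2 * ψ (√E * s)
    have hw' : Continuous fun s => w s * s ^ 2 / 2 := by fun_prop
    have hF : Continuous F :=
      (contDiff_integral_mul_comp_mul hw hφ a b).continuous.comp Real.continuous_sqrt
    have hG : Continuous G :=
      (contDiff_integral_mul_comp_mul hw' hψ a b).continuous.comp Real.continuous_sqrt
    have hpos : ∀ E, 0 < E → HasDerivAt F (G E) E := fun E hE => by
      have hd := (hasDerivAt_integral_mul_comp_mul hw hφ.hasDerivAt_deriv_of_infty
        hφ.deriv_of_infty.continuous a b (√E)).comp E (Real.hasDerivAt_sqrt hE.ne')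
      refine hd.congr_deriv ?_
      rw [← integral_mul_const]
      refine integral_congr fun s _ => ?_
      have : √E ≠ 0 := (Real.sqrt_pos.2 hE).ne'
      simp only [h]
      field_simp
    have hder : ∀ E ∈ Ici (0 : ℝ), HasDerivWithinAt F (G E) (Ici 0) E := fun E hE => by
      rcases (mem_Ici.1 hE).eq_or_lt with rfl | hE
      · refine hasDerivWithinAt_Ici_of_tendsto_deriv (s := Ioi 0)
          (fun x hx => (hpos x hx).differentiableAt.differentiableWithinAt)
          hF.continuousWithinAt self_mem_nhdsWithin ?_
        refine (hG.continuousWithinAt (s := Ioi 0) (x := 0)).tendsto.congr' ?_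
        filter_upwards [self_mem_nhdsWithin] with x hx using (hpos x hx).deriv.symm
      · exact (hpos E hE).hasDerivWithinAt
    push_cast
    refine (contDiffOn_succ_iff_derivWithin (uniqueDiffOn_Ici 0)).2
      ⟨fun E hE => (hder E hE).differentiableWithinAt, by simp, ?_⟩
    exact (ih hw' hψ hψe).congr fun E hE => (hder E hE).derivWithin (uniqueDiffOn_Ici 0 E hE)

/-- A single well potential is the square of a smooth coordinate on the line. -/
theorem exists_homeomorph_sq_eq (V : ℝ → ℝ)
    (hV : ContDiff ℝ (⊤ : ℕ∞) V)
    (hV0 : V 0 = 0)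
    (hVcrit : ∀ t : ℝ, deriv V t = 0 ↔ t = 0)
    (hV'' : deriv (deriv V) 0 = 2)
    (hVtop : Tendsto V atTop atTop)
    (hVbot : Tendsto V atBot atTop) :
    ∃ f : ℝ ≃ₜ ℝ, StrictMono f ∧ f 0 = 0 ∧ (∀ t, f t ^ 2 = V t) ∧
      ContDiff ℝ (⊤ : ℕ∞) f.symm ∧ deriv f.symm 0 = 1 := by
  obtain ⟨t₀, ht₀⟩ := hV.continuous.exists_forall_le
    (by rw [cocompact_eq_atBot_atTop]; exact hVbot.sup hVtop)
  have hmin : ∀ t, (∀ s, V t ≤ V s) → t = 0 := fun t ht =>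
    (hVcrit t).1 (IsLocalMin.deriv_eq_zero (Eventually.of_forall ht))
  obtain rfl := hmin t₀ ht₀
  rw [hV0] at ht₀
  have hVpos : ∀ t, t ≠ 0 → 0 < V t := fun t ht =>
    (ht₀ t).lt_of_ne fun h => ht (hmin t (by rwa [← h]))
  obtain ⟨q, hq, hVq⟩ := exists_contDiff_eq_mul hV hV0
  have hV' : ∀ t, deriv V t = q t + t * deriv q t := fun t => by
    have h := (hasDerivAt_id t).mul (hq.hasDerivAt_deriv_of_infty t)
    rw [show V = id * q from funext hVq, h.deriv]
    simp
  obtain ⟨g, hg, hqg⟩ := exists_contDiff_eq_mul hq (by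
    have := (hVcrit 0).2 rfl
    rw [hV'] at this
    simpa using this)
  have hq' : ∀ t, deriv q t = g t + t * deriv g t := fun t => by
    have h := (hasDerivAt_id t).mul (hg.hasDerivAt_deriv_of_infty t)
    rw [show q = id * g from funext hqg, h.deriv]
    simp
  have hg0 : g 0 = 1 := by
    have h := (hq.hasDerivAt_deriv_of_infty 0).add
      ((hasDerivAt_id 0).mul (hq.deriv_of_infty.hasDerivAt_deriv_of_infty 0))
    have h2 : deriv V = q + id * deriv q := funext hV'
    rw [h2, h.deriv, hq'] at hV''
    simp only [id, zero_mul, add_zero, one_mul] at hV''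
    linarith
  have hgpos : ∀ t, 0 < g t := fun t => by
    rcases eq_or_ne t 0 with rfl | ht
    · simp [hg0]
    · have := hVpos t ht
      rw [hVq, hqg, ← mul_assoc] at this
      exact pos_of_mul_pos_right this (mul_self_nonneg t)
  set f : ℝ → ℝ := fun t => t * √(g t) with hf_def
  have hf : ContDiff ℝ (⊤ : ℕ∞) f := contDiff_id.mul (hg.sqrt fun t => (hgpos t).ne')
  have hfV : ∀ t, f t ^ 2 = V t := fun t => by
    rw [hVq, hqg, hf_def]
    simp only [mul_pow, Real.sq_sqrt (hgpos t).le]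
    ring
  have hf0 : f 0 = 0 := by simp [hf_def]
  have hf'0 : deriv f 0 = 1 := by
    have h := (hasDerivAt_id (0 : ℝ)).mul
      ((hg.sqrt fun t => (hgpos t).ne').hasDerivAt_deriv_of_infty 0)
    have h2 : f = id * fun t => √(g t) := rfl
    rw [h2, h.deriv]
    simp [hg0]
  have hf'ne : ∀ t, deriv f t ≠ 0 := fun t ht => by
    have h := (hf.hasDerivAt_deriv_of_infty t).pow 2
    have h2 : f ^ 2 = V := funext hfV
    rw [h2, ht] at h
    have h3 := (hVcrit t).1 (by rw [h.deriv]; simp)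
    rw [h3, hf'0] at ht
    exact one_ne_zero ht
  have hf'pos : ∀ t, 0 < deriv f t := fun t => by
    by_contra! hneg
    obtain ⟨c, hc⟩ := mem_range_of_exists_le_of_exists_ge hf.deriv_of_infty.continuous
      ⟨t, hneg⟩ ⟨0, by rw [hf'0]; exact zero_le_one⟩
    exact hf'ne c hc
  have hmono : StrictMono f := strictMono_of_deriv_pos hf'pos
  have hsurj : Function.Surjective f := by
    refine hf.continuous.surjective ?_ ?_
    · refine (Real.tendsto_sqrt_atTop.comp hVtop).congr' ?_
      filter_upwards [eventually_ge_atTop 0] with t ht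
      rw [Function.comp_apply, ← hfV, Real.sqrt_sq (mul_nonneg ht (Real.sqrt_nonneg _))]
    · refine (tendsto_neg_atTop_atBot.comp (Real.tendsto_sqrt_atTop.comp hVbot)).congr' ?_
      filter_upwards [eventually_le_atBot 0] with t ht
      have h : f t ≤ 0 := mul_nonpos_of_nonpos_of_nonneg ht (Real.sqrt_nonneg _)
      rw [Function.comp_apply, Function.comp_apply, ← hfV, Real.sqrt_sq_eq_abs, abs_of_nonpos h,
        neg_neg]
  set e : ℝ ≃ₜ ℝ := (hmono.orderIsoOfSurjective f hsurj).toHomeomorph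
  have he : ∀ t, e t = f t := fun t => rfl
  have hsymm0 : e.symm 0 = 0 := by rw [Homeomorph.symm_apply_eq, he, hf0]
  refine ⟨e, hmono, hf0, hfV, e.contDiff_symm_deriv hf'ne hf.hasDerivAt_deriv_of_infty hf, ?_⟩
  have h : HasDerivAt e.symm (deriv f 0)⁻¹ 0 :=
    HasDerivAt.of_local_left_inverse e.symm.continuous.continuousAt
      (by rw [hsymm0]; exact hf.hasDerivAt_deriv_of_infty 0) (hf'ne 0)
      (Eventually.of_forall e.apply_symm_apply)
  rw [h.deriv, hf'0, inv_one]

/-- With `V` a single well potential and turning points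
`t₋(E) < 0 < t₊(E)`, the function `J(E) = (1/π) ∫_{t₋(E)}^{t₊(E)} √(E - V t) dt`
extends to a `C^∞` function on `[0, ∞)` with `J(0) = 0` and `J'(0) = 1/2`. -/
theorem stmt3 (V : ℝ → ℝ)
    (hV : ContDiff ℝ (⊤ : ℕ∞) V)
    (hV0 : V 0 = 0)
    (hVcrit : ∀ t : ℝ, deriv V t = 0 ↔ t = 0)
    (hV'' : deriv (deriv V) 0 = 2)
    (hVtop : Tendsto V atTop atTop)
    (hVbot : Tendsto V atBot atTop)
    (tm tp : ℝ → ℝ)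
    (htm : ∀ E : ℝ, 0 < E → tm E < 0 ∧ V (tm E) = E)
    (htp : ∀ E : ℝ, 0 < E → 0 < tp E ∧ V (tp E) = E)
    (J : ℝ → ℝ)
    (hJ : ∀ E : ℝ, 0 < E →
      J E = (1 / Real.pi) * ∫ t in tm E..tp E, Real.sqrt (E - V t)) :
    ∃ Jext : ℝ → ℝ,
      ContDiffOn ℝ (⊤ : ℕ∞) Jext (Ici 0) ∧
      (∀ E : ℝ, 0 < E → Jext E = J E) ∧
      Jext 0 = 0 ∧
      derivWithin Jext (Ici 0) 0 = 1 / 2 := by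
  obtain ⟨f, hmono, hf0, hfV, hh, hh0⟩ :=
    exists_homeomorph_sq_eq V hV hV0 hVcrit hV'' hVtop hVbot
  set h : ℝ → ℝ := ⇑f.symm
  set k : ℝ → ℝ := fun x => (deriv h x + deriv h (-x)) / 2 with hk_def
  set w : ℝ → ℝ := fun s => √(1 - s ^ 2)
  have hw : Continuous w := by fun_prop
  have hh' := hh.deriv_of_infty
  have hh'c : Continuous (deriv h) := hh'.continuous
  have hk : ContDiff ℝ (⊤ : ℕ∞) k := (hh'.add (hh'.comp contDiff_neg)).div_const 2
  have hkeven : ∀ x, k (-x) = k x := fun x => by simp only [hk_def, neg_neg, add_comm]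
  have hF := contDiffOn_integral_mul_comp_sqrt_mul hw hk hkeven (-1) 1
  set F : ℝ → ℝ := fun E => ∫ s in (-1 : ℝ)..1, w s * k (√E * s) with hF_def
  have hsymmetrize : ∀ r, ∫ s in (-1 : ℝ)..1, w s * k (r * s) =
      ∫ s in (-1 : ℝ)..1, w s * deriv h (r * s) := fun r => by
    have h1 : ∫ s in (-1 : ℝ)..1, w s * deriv h (-(r * s)) =
        ∫ s in (-1 : ℝ)..1, w s * deriv h (r * s) := by
      have := integral_comp_neg (a := -1) (b := 1) fun s => w s * deriv h (r * s)
      simpa [w] using this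
    have h2 : ∫ s in (-1 : ℝ)..1, w s * k (r * s) =
        ∫ s in (-1 : ℝ)..1, (w s * deriv h (r * s) + w s * deriv h (-(r * s))) / 2 :=
      integral_congr fun s _ => by simp only [hk_def]; ring
    rw [h2, integral_div, integral_add (Continuous.intervalIntegrable (by fun_prop) _ _)
      (Continuous.intervalIntegrable (by fun_prop) _ _), h1]
    ring
  refine ⟨fun E => E * F E / Real.pi, (contDiffOn_id.mul hF).div_const _, fun E hE => ?_,
    by simp, ?_⟩
  · have hr2 : √E ^ 2 = E := Real.sq_sqrt hE.le
    have htp' : tp E = h (√E * 1) := by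
      rw [mul_one]
      refine (f.symm_apply_eq.2 ?_).symm
      have hpos : 0 ≤ f (tp E) := by
        rw [← hf0]
        exact (hmono (htp E hE).1).le
      rw [← Real.sqrt_sq hpos, hfV, (htp E hE).2]
    have htm' : tm E = h (√E * (-1)) := by
      refine (f.symm_apply_eq.2 ?_).symm
      have hneg : f (tm E) ≤ 0 := by
        rw [← hf0]
        exact (hmono (htm E hE).1).le
      rw [mul_neg_one, ← neg_neg (f (tm E)), ← Real.sqrt_sq (neg_nonneg.2 hneg), neg_sq, hfV,
        (htm E hE).2]
    have hVc : Continuous V := hV.continuous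
    have hsub := integral_comp_mul_deriv (a := -1) (b := 1) (f := fun s => h (√E * s))
      (f' := fun s => deriv h (√E * s) * √E) (g := fun t => √(E - V t))
      (fun s _ => by
        have := (hh.hasDerivAt_deriv_of_infty (√E * s)).comp s
          ((hasDerivAt_id s).const_mul (√E))
        exact this.congr_deriv (by rw [mul_one]))
      (Continuous.continuousOn (by fun_prop)) (by fun_prop)
    rw [hJ E hE, htp', htm', ← hsub, hF_def]
    simp only [hsymmetrize]
    have : ∀ s, √(E - V (h (√E * s))) = √E * w s := fun s => by
      rw [← hfV, f.apply_symm_apply, mul_pow, hr2, ← mul_one_sub, Real.sqrt_mul hE.le]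
    simp only [Function.comp_apply, this]
    rw [one_div_mul_eq_div, ← integral_const_mul]
    congr 1
    refine integral_congr fun s _ => ?_
    linear_combination -(w s * deriv h (√E * s)) * hr2
  · have hF0 : F 0 = Real.pi / 2 := by
      simp only [hF_def, hk_def, Real.sqrt_zero, zero_mul, neg_zero, hh0, w]
      norm_num
      exact integral_sqrt_one_sub_sq
    have hd := ((hasDerivWithinAt_id (0 : ℝ) (Ici 0)).mul
      ((hF.differentiableOn (by simp)) 0 self_mem_Ici).hasDerivWithinAt).div_const Real.pi
    refine (hd.derivWithin (uniqueDiffOn_Ici 0 0 self_mem_Ici)).trans ?_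
    have := Real.pi_ne_zero
    simp [hF0]
    field_simp
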